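/- There is an absolute constant K such that for every non-principal Dirichlet character χ modulo m, every nonzero integer f, and every real x ≥ 2: (i) | Σ_{n ≤ x, gcd(n, f) = 1} χ(n)/φ(n) − L(1, χ) c(χ, f) | ≤ K τ(f) m^{1/2} (log m)(log x) / x, and (ii) | Σ_{n ≤ x, gcd(n, f) = 1} χ(n) n / φ(n) | ≤ K τ(f) m^{1/2} (log m)(log x). -/

import Mathlib

/-- `c(χ, f) = ∏_{p ∤ f} (1 + χ(p)/(p(p−1))) · ∏_{p ∣ f} (1 − χ(p)/p)`. -/
noncomputable def cChi {N : ℕ} (ψ : DirichletCharacter ℂ N) (f : ℤ) : ℂ :=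
  ∏' p : Nat.Primes, if (p : ℤ) ∣ f then 1 - ψ ((p : ℕ) : ZMod N) / (p : ℕ)
    else 1 + ψ ((p : ℕ) : ZMod N) / ((p : ℕ) * ((p : ℕ) - 1))

/-- `L(1, ψ)`, the value at `s = 1` of the Dirichlet L-function of `ψ` (modulus positive). -/
noncomputable def Lone {N : ℕ} (ψ : DirichletCharacter ℂ N) : ℂ :=
  if h : N ≠ 0 then
    letI : NeZero N := ⟨h⟩
    DirichletCharacter.LFunction ψ 1
  else 0


open ZMod in
lemma gauss_key {q : ℕ} [NeZero q] (χ : DirichletCharacter ℂ q) (hχ : χ.IsPrimitive) (n : ZMod q) :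
    (q : ℂ) * χ n = gaussSum χ stdAddChar * ∑ k : ZMod q, stdAddChar (k * n) * χ⁻¹ (-k) := by
  have h := congrFun (dft_dft (N := q) (E := ℂ) (fun j => χ j)) (-n)
  simp only [neg_neg, smul_eq_mul] at h
  rw [← h, dft_apply, Finset.mul_sum]
  refine Finset.sum_congr rfl fun k _ => ?_
  have := hχ.fourierTransform_eq_inv_mul_gaussSum k
  rw [this, smul_eq_mul, mul_neg, neg_neg]
  ring

open ZMod in
lemma gauss_norm {q : ℕ} [NeZero q] (χ : DirichletCharacter ℂ q) (hχ : χ.IsPrimitive) :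
    ‖gaussSum χ (stdAddChar (N := q))‖ = √q := by
  have h := gauss_key χ hχ 1
  have h2 : star (gaussSum χ (stdAddChar (N := q))) = ∑ k : ZMod q, stdAddChar (k * 1) * χ⁻¹ (-k) := by
    rw [star_gaussSum_eq, gaussSum]
    rw [← Equiv.sum_comp (Equiv.neg (ZMod q))]
    refine Finset.sum_congr rfl fun k _ => ?_
    simp [AddChar.inv_apply, mul_comm]
  rw [← h2] at h
  have h3 := congrArg norm h
  simp only [norm_mul, norm_star, map_one, mul_one, Complex.norm_natCast] at h3
  rw [h3, Real.sqrt_mul_self (norm_nonneg _)]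

open ZMod in
lemma geom_bound {q : ℕ} [NeZero q] (a : ℕ) (ha : 0 < a) (haq : a < q) (N : ℕ) :
    ‖∑ n ∈ Finset.range N, (stdAddChar ((a : ZMod q) * (n : ZMod q)) : ℂ)‖ ≤
      (q : ℝ) / 2 * (1 / (a : ℝ) + 1 / ((q : ℝ) - a)) := by
  set z : ℂ := stdAddChar (a : ZMod q) with hz
  have hzn : ∀ n : ℕ, (stdAddChar ((a : ZMod q) * (n : ZMod q)) : ℂ) = z ^ n := by
    intro n
    rw [hz, ← AddChar.map_nsmul_eq_pow, nsmul_eq_mul, mul_comm]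
  have hz1 : ‖z‖ = 1 := by
    rw [hz]; exact Circle.norm_coe _
  have hq : (0 : ℝ) < q := by exact_mod_cast (ha.trans haq)
  have ha' : (0 : ℝ) < a := by exact_mod_cast ha
  have haq' : (a : ℝ) < q := by exact_mod_cast haq
  have hz2 : ‖z - 1‖ = 2 * Real.sin (Real.pi * (a / q)) := by
    have := stdAddChar_coe (N := q) (a : ℤ)
    simp only [Int.cast_natCast] at this
    rw [hz, this]
    have h := Complex.norm_exp_I_mul_ofReal_sub_one (2 * Real.pi * (a / q))
    have e : Complex.I * ((2 * Real.pi * (a / q) : ℝ) : ℂ) = 2 * Real.pi * Complex.I * a / q := by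
      push_cast; ring
    rw [e] at h
    rw [h]
    have e2 : 2 * Real.pi * ((a : ℝ) / q) / 2 = Real.pi * (a / q) := by ring
    rw [e2, Real.norm_eq_abs, abs_of_nonneg]
    have : Real.pi * ((a : ℝ) / q) ≤ Real.pi := by
      have : (a : ℝ) / q ≤ 1 := by rw [div_le_one hq]; exact haq'.le
      nlinarith [Real.pi_pos]
    have := Real.sin_nonneg_of_nonneg_of_le_pi (by positivity) this
    positivity
  have hlow : 4 * min (a : ℝ) (q - a) / q ≤ ‖z - 1‖ := by
    rw [hz2]
    rcases le_total ((a : ℝ)) (q - a) with h | h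
    · rw [min_eq_left h]
      have := Real.mul_le_sin (x := Real.pi * (a / q)) (by positivity) (by
        have : (a : ℝ) / q ≤ 1 / 2 := by rw [div_le_iff₀ hq]; linarith
        nlinarith [Real.pi_pos])
      have e : 2 / Real.pi * (Real.pi * ((a : ℝ) / q)) = 2 * a / q := by
        field_simp
      rw [e] at this
      calc 4 * (a : ℝ) / q = 2 * (2 * a / q) := by ring
        _ ≤ _ := by linarith
    · rw [min_eq_right h]
      have e0 : Real.sin (Real.pi * (a / q)) = Real.sin (Real.pi * ((q - a) / q)) := by
        rw [← Real.sin_pi_sub]; congr 1; field_simp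
      rw [e0]
      have hqa : 0 < (q : ℝ) - a := by linarith
      have := Real.mul_le_sin (x := Real.pi * ((q - a) / q)) (by positivity) (by
        have : ((q : ℝ) - a) / q ≤ 1 / 2 := by rw [div_le_iff₀ hq]; linarith
        nlinarith [Real.pi_pos])
      have e : 2 / Real.pi * (Real.pi * (((q : ℝ) - a) / q)) = 2 * (q - a) / q := by
        field_simp
      rw [e] at this
      calc 4 * ((q : ℝ) - a) / q = 2 * (2 * (q - a) / q) := by ring
        _ ≤ _ := by linarith
  have hmin : 0 < min (a : ℝ) (q - a) := lt_min ha' (by linarith)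
  have hpos : 0 < ‖z - 1‖ := lt_of_lt_of_le (by positivity) hlow
  have hne : z ≠ 1 := fun h => by rw [h] at hpos; simp at hpos
  rw [Finset.sum_congr rfl fun n _ => hzn n, geom_sum_eq hne, norm_div]
  calc ‖z ^ N - 1‖ / ‖z - 1‖ ≤ 2 / (4 * min (a : ℝ) (q - a) / q) := by
        gcongr
        calc ‖z ^ N - 1‖ ≤ ‖z ^ N‖ + ‖(1 : ℂ)‖ := norm_sub_le _ _
          _ = 2 := by rw [norm_pow, hz1]; norm_num
    _ = q / 2 * (1 / min (a : ℝ) (q - a)) := by field_simp; norm_num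
    _ ≤ _ := by
        gcongr
        have hqa : 0 < (q : ℝ) - a := by linarith
        rcases le_total ((a : ℝ)) (q - a) with h | h
        · rw [min_eq_left h]; have : 0 < 1 / ((q : ℝ) - a) := by positivity
          linarith
        · rw [min_eq_right h]; have : 0 < 1 / (a : ℝ) := by positivity
          linarith

lemma harm (N : ℕ) : ∑ k ∈ Finset.Icc 1 N, 1 / (k : ℝ) ≤ 1 + Real.log N := by
  have h := harmonic_le_one_add_log N
  rw [harmonic_eq_sum_Icc] at h
  push_cast at h
  simpa [one_div] using h

open ZMod in
lemma pv_prim {q : ℕ} [NeZero q] (hq1 : q ≠ 1) (χ : DirichletCharacter ℂ q) (hχ : χ.IsPrimitive) (N : ℕ) :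
    ‖∑ n ∈ Finset.range N, χ (n : ZMod q)‖ ≤ √q * (1 + Real.log q) := by
  have hq0 : (0 : ℝ) < q := by exact_mod_cast (NeZero.pos q)
  have key : (q : ℂ) * ∑ n ∈ Finset.range N, χ (n : ZMod q) = gaussSum χ stdAddChar *
      ∑ k : ZMod q, χ⁻¹ (-k) * ∑ n ∈ Finset.range N, (stdAddChar (k * (n : ZMod q)) : ℂ) := by
    have h1 : ∑ n ∈ Finset.range N, (q : ℂ) * χ (n : ZMod q) = ∑ n ∈ Finset.range N,
        gaussSum χ stdAddChar * ∑ k : ZMod q, stdAddChar (k * (n : ZMod q)) * χ⁻¹ (-k) :=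
      Finset.sum_congr rfl fun n _ => gauss_key χ hχ (n : ZMod q)
    rw [Finset.mul_sum, h1, ← Finset.mul_sum, Finset.sum_comm]
    congr 1
    refine Finset.sum_congr rfl fun k _ => ?_
    rw [Finset.mul_sum]
    exact Finset.sum_congr rfl fun n _ => mul_comm _ _
  have hz : ∀ F : ZMod q → ℂ, ∑ k : ZMod q, F k = ∑ a ∈ Finset.range q, F (a : ZMod q) := by
    intro F
    refine Finset.sum_bij' (fun k _ => k.val) (fun a _ => (a : ZMod q)) ?_ ?_ ?_ ?_ ?_
    · intro k _; simpa using ZMod.val_lt k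
    · simp
    · simp
    · intro a ha; exact ZMod.val_cast_of_lt (by simpa using ha)
    · simp
  have hb : ‖∑ k : ZMod q, χ⁻¹ (-k) * ∑ n ∈ Finset.range N, (stdAddChar (k * (n : ZMod q)) : ℂ)‖
      ≤ q * (1 + Real.log q) := by
    rw [hz, Finset.range_eq_Ico, Finset.sum_eq_sum_Ico_succ_bot (NeZero.pos q)]
    have h0 : χ⁻¹ (0 : ZMod q) = 0 := χ⁻¹.map_zero' hq1
    simp only [Nat.cast_zero, neg_zero, h0, zero_mul, zero_add]
    calc _ ≤ ∑ a ∈ Finset.Ico 1 q, (q : ℝ) / 2 * (1 / (a : ℝ) + 1 / ((q : ℝ) - a)) := by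
          refine norm_sum_le_of_le _ fun a ha => ?_
          rw [Finset.mem_Ico] at ha
          rw [norm_mul]
          calc _ ≤ 1 * _ := mul_le_mul (DirichletCharacter.norm_le_one _ _)
                (geom_bound a ha.1 ha.2 N) (norm_nonneg _) zero_le_one
            _ = _ := one_mul _
      _ = (q : ℝ) / 2 * (∑ a ∈ Finset.Ico 1 q, 1 / (a : ℝ) + ∑ a ∈ Finset.Ico 1 q, 1 / ((q : ℝ) - a)) := by
          rw [← Finset.mul_sum, Finset.sum_add_distrib]
      _ = (q : ℝ) / 2 * (∑ a ∈ Finset.Ico 1 q, 1 / (a : ℝ) + ∑ a ∈ Finset.Ico 1 q, 1 / (a : ℝ)) := by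
          congr 2
          refine Finset.sum_bij' (fun a _ => q - a) (fun a _ => q - a) ?_ ?_ ?_ ?_ ?_
          · intro a ha; simp at *; omega
          · intro a ha; simp at *; omega
          · intro a ha; simp at *; omega
          · intro a ha; simp at *; omega
          · intro a ha; simp at ha; rw [Nat.cast_sub ha.2.le]
      _ = (q : ℝ) * ∑ a ∈ Finset.Ico 1 q, 1 / (a : ℝ) := by ring
      _ ≤ q * ∑ k ∈ Finset.Icc 1 q, 1 / (k : ℝ) := by
          gcongr
          exact Finset.Ico_subset_Icc_self
      _ ≤ _ := by gcongr; exact harm q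
  have h := congrArg norm key
  rw [norm_mul, norm_mul, gauss_norm χ hχ, Complex.norm_natCast] at h
  have h2 : (q : ℝ) * ‖∑ n ∈ Finset.range N, χ (n : ZMod q)‖ ≤ q * (√q * (1 + Real.log q)) := by
    rw [h]
    calc _ ≤ √q * (q * (1 + Real.log q)) := by gcongr
      _ = _ := by ring
  exact le_of_mul_le_mul_left h2 hq0

lemma conv_sum {E : Type*} [AddCommMonoid E] (N : ℕ) (F : ℕ → ℕ → E) :
    ∑ n ∈ Finset.Icc 1 N, ∑ d ∈ n.divisors, F d (n / d) =
      ∑ d ∈ Finset.Icc 1 N, ∑ k ∈ Finset.Icc 1 (N / d), F d k := by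
  rw [Finset.sum_sigma', Finset.sum_sigma']
  refine Finset.sum_bij' (fun p _ => ⟨p.2, p.1 / p.2⟩) (fun p _ => ⟨p.1 * p.2, p.1⟩) ?_ ?_ ?_ ?_ ?_
  · rintro ⟨n, d⟩ h
    simp only [Finset.mem_sigma, Finset.mem_Icc, Nat.mem_divisors] at h ⊢
    obtain ⟨⟨h1, h2⟩, ⟨k, rfl⟩, h4⟩ := h
    have hd : 0 < d := Nat.pos_of_ne_zero (by rintro rfl; simp at h4)
    have hk : 0 < k := Nat.pos_of_ne_zero (by rintro rfl; simp at h4)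
    rw [Nat.mul_div_cancel_left _ hd]
    refine ⟨⟨hd, by nlinarith⟩, hk, ?_⟩
    rw [Nat.le_div_iff_mul_le hd]; linarith
  · rintro ⟨d, k⟩ h
    simp only [Finset.mem_sigma, Finset.mem_Icc, Nat.mem_divisors] at h ⊢
    obtain ⟨⟨h1, h2⟩, h3, h4⟩ := h
    rw [Nat.le_div_iff_mul_le h1] at h4
    have : 0 < d * k := by positivity
    exact ⟨⟨this, by linarith⟩, Dvd.intro _ rfl, this.ne'⟩
  · rintro ⟨n, d⟩ h
    simp only [Finset.mem_sigma, Finset.mem_Icc, Nat.mem_divisors] at h ⊢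
    simp [Nat.mul_div_cancel' h.2.1]
  · rintro ⟨d, k⟩ h
    simp only [Finset.mem_sigma, Finset.mem_Icc, Nat.mem_divisors] at h ⊢
    simp [Nat.mul_div_cancel_left _ (show 0 < d from h.1.1)]
  · rintro ⟨n, d⟩ h
    rfl

noncomputable def bb (β : ℕ → ℝ) (d : ℕ) : ℝ :=
  if Squarefree d then ∏ p ∈ d.primeFactors, β p else 0

lemma bb_one (β : ℕ → ℝ) : bb β 1 = 1 := by simp [bb]

lemma bb_mul (β : ℕ → ℝ) {a b : ℕ} (h : a.Coprime b) : bb β (a * b) = bb β a * bb β b := by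
  unfold bb
  by_cases ha : Squarefree a <;> by_cases hb : Squarefree b <;>
    simp [Nat.squarefree_mul h, h.primeFactors_mul, ha, hb]
  exact Finset.prod_union h.disjoint_primeFactors

lemma bb_sum (β : ℕ → ℝ) {n : ℕ} (hn : n ≠ 0) :
    ∑ d ∈ n.divisors, bb β d = ∏ p ∈ n.primeFactors, (1 + β p) := by
  unfold bb
  rw [← Finset.sum_filter, Finset.prod_one_add]
  have himg : n.divisors.filter Squarefree = n.primeFactors.powerset.image (fun t => ∏ p ∈ t, p) := by
    ext d
    simp only [Finset.mem_filter, Nat.mem_divisors, Finset.mem_image, Finset.mem_powerset]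
    constructor
    · rintro ⟨⟨h1, h2⟩, h3⟩
      exact ⟨d.primeFactors, Nat.primeFactors_mono h1 h2, Nat.prod_primeFactors_of_squarefree h3⟩
    · rintro ⟨t, ht, rfl⟩
      refine ⟨⟨(Finset.prod_dvd_prod_of_subset _ _ _ ht).trans (Nat.prod_primeFactors_dvd n), hn⟩, ?_⟩
      exact (Finset.squarefree_prod_of_pairwise_isCoprime (fun p hp q hq hpq => Nat.coprime_iff_isRelPrime.1 ((Nat.coprime_primes (Nat.prime_of_mem_primeFactors (ht hp)) (Nat.prime_of_mem_primeFactors (ht hq))).2 hpq))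
        fun p hp => (Nat.prime_of_mem_primeFactors (ht hp)).prime.squarefree)
  rw [himg, Finset.sum_image]
  · refine Finset.sum_congr rfl fun t ht => ?_
    rw [Nat.primeFactors_prod]
    intro p hp
    exact Nat.prime_of_mem_primeFactors (Finset.mem_powerset.1 ht hp)
  · intro s hs t ht h
    have e : ∀ u ∈ n.primeFactors.powerset, (∏ p ∈ u, p).primeFactors = u := fun u hu =>
      Nat.primeFactors_prod fun p hp => Nat.prime_of_mem_primeFactors (Finset.mem_powerset.1 hu hp)
    rw [← e s hs, ← e t ht]
    exact congrArg _ h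

lemma card_div_le (r : ℕ) : (r.divisors.card : ℝ) ≤ 2 * √r := by
  have h : r.divisors ⊆ Finset.Icc 1 r.sqrt ∪ (Finset.Icc 1 r.sqrt).image (r / ·) := by
    intro d hd
    rw [Nat.mem_divisors] at hd
    obtain ⟨⟨k, rfl⟩, h2⟩ := hd
    have hd : 0 < d := Nat.pos_of_ne_zero (by rintro rfl; simp at h2)
    have hk : 0 < k := Nat.pos_of_ne_zero (by rintro rfl; simp at h2)
    rw [Finset.mem_union, Finset.mem_image]
    rcases le_total d k with h | h
    · left
      rw [Finset.mem_Icc, Nat.le_sqrt]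
      exact ⟨hd, by nlinarith⟩
    · right
      refine ⟨k, ?_, Nat.mul_div_cancel _ hk⟩
      rw [Finset.mem_Icc, Nat.le_sqrt]
      exact ⟨hk, by nlinarith⟩
  have h1 := (Finset.card_le_card h).trans (Finset.card_union_le _ _)
  have h2 : ((Finset.Icc 1 r.sqrt).image (r / ·)).card ≤ (Finset.Icc 1 r.sqrt).card := Finset.card_image_le
  rw [Nat.card_Icc] at *
  have h3 : r.divisors.card ≤ 2 * r.sqrt := by omega
  have h4 : (r.sqrt : ℝ) ≤ √r := Real.nat_sqrt_le_real_sqrt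
  have : (r.divisors.card : ℝ) ≤ 2 * r.sqrt := by exact_mod_cast h3
  linarith

lemma bb_gcd (r : ℕ) {n : ℕ} (hn : n ≠ 0) :
    ∑ d ∈ n.divisors, bb (fun p => if p ∣ r then -1 else 0) d = if n.Coprime r then 1 else 0 := by
  rw [bb_sum _ hn]
  split_ifs with h
  · refine Finset.prod_eq_one fun p hp => ?_
    have hp' := Nat.prime_of_mem_primeFactors hp
    have : ¬ p ∣ r := fun hr => hp'.one_lt.ne' (Nat.eq_one_of_dvd_coprimes h (Nat.dvd_of_mem_primeFactors hp) hr)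
    simp [this]
  · obtain ⟨p, hp, h1, h2⟩ := Nat.Prime.not_coprime_iff_dvd.1 h
    exact Finset.prod_eq_zero (Nat.mem_primeFactors.2 ⟨hp, h1, hn⟩) (by simp [h2])

lemma bb_gcd_abs (r : ℕ) (d : ℕ) :
    |bb (fun p => if p ∣ r then -1 else 0) d| ≤ if d ∣ r then 1 else 0 := by
  unfold bb
  by_cases h : Squarefree d
  · rw [if_pos h, Finset.abs_prod]
    split_ifs with h1
    · refine Finset.prod_le_one (fun _ _ => abs_nonneg _) fun p _ => ?_
      split_ifs <;> simp
    · have : ∃ p ∈ d.primeFactors, ¬ p ∣ r := by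
        by_contra hc
        push Not at hc
        apply h1
        rw [← Nat.prod_primeFactors_of_squarefree h]
        exact Finset.prod_primes_dvd _ (fun p hp => (Nat.prime_of_mem_primeFactors hp).prime) hc
      obtain ⟨p, hp, hpr⟩ := this
      rw [Finset.prod_eq_zero hp (by simp [hpr])]
  · rw [if_neg h]; split_ifs <;> simp


lemma log2_low : (1/2 : ℝ) ≤ Real.log 2 := by have := Real.log_two_gt_d9; linarith

lemma norm_sum_Icc {m : ℕ} (hm : m ≠ 1) (χ : DirichletCharacter ℂ m) (N : ℕ) :
    ∑ n ∈ Finset.Icc 1 N, χ (n : ZMod m) = ∑ n ∈ Finset.range (N + 1), χ (n : ZMod m) := by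
  have h0 : χ (0 : ZMod m) = 0 := χ.map_zero' hm
  rw [Finset.range_eq_Ico, Finset.sum_eq_sum_Ico_succ_bot (Nat.succ_pos N)]
  simp only [Nat.cast_zero, h0, zero_add]
  rfl

lemma pv_gen {m : ℕ} (hm : 0 < m) (χ : DirichletCharacter ℂ m) (hχ : χ ≠ 1) (N : ℕ) :
    ‖∑ n ∈ Finset.Icc 1 N, χ (n : ZMod m)‖ ≤ 6 * √m * Real.log m := by
  have : NeZero m := ⟨hm.ne'⟩
  set q := χ.conductor with hq
  have hqm : q ∣ m := χ.conductor_dvd_level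
  have hq0 : q ≠ 0 := χ.conductor_ne_zero
  have : NeZero q := ⟨hq0⟩
  have hq1 : q ≠ 1 := fun h => hχ (DirichletCharacter.eq_one_iff_conductor_eq_one.2 h)
  obtain ⟨r, hr⟩ := hqm
  set ψ : DirichletCharacter ℂ q := χ.primitiveCharacter with hψ
  have hψp : ψ.IsPrimitive := χ.primitiveCharacter_isPrimitive
  set B : ℝ := √q * (1 + Real.log q)
  have hB0 : 0 ≤ B := (norm_nonneg _).trans (pv_prim hq1 ψ hψp 0)
  have hB : ∀ M : ℕ, ‖∑ n ∈ Finset.Icc 1 M, ψ (n : ZMod q)‖ ≤ B := fun M => by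
    rw [norm_sum_Icc hq1]; exact pv_prim hq1 ψ hψp _
  set μ := bb (fun p => if p ∣ r then -1 else 0)
  have hval : ∀ n : ℕ, n ≠ 0 → χ (n : ZMod m) =
      ∑ d ∈ n.divisors, ((μ d : ℂ) * ψ (d : ZMod q)) * ψ ((n / d : ℕ) : ZMod q) := by
    intro n hn
    have h1 : ∑ d ∈ n.divisors, ((μ d : ℂ) * ψ (d : ZMod q)) * ψ ((n / d : ℕ) : ZMod q)
        = ((∑ d ∈ n.divisors, μ d : ℝ) : ℂ) * ψ (n : ZMod q) := by
      push_cast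
      rw [Finset.sum_mul]
      refine Finset.sum_congr rfl fun d hd => ?_
      rw [mul_assoc, ← map_mul, ← Nat.cast_mul, Nat.mul_div_cancel' (Nat.dvd_of_mem_divisors hd)]
    rw [h1, bb_gcd r hn]
    by_cases hc : n.Coprime m
    · have hcr : n.Coprime r := hc.coprime_dvd_right (Dvd.intro_left _ hr.symm)
      have := χ.primitiveCharacter_apply_of_isCoprime (a := n) (Nat.isCoprime_iff_coprime.2 hc)
      simp only [Int.cast_natCast] at this
      rw [if_pos hcr, hψ, this]; simp
    · have hz : χ (n : ZMod m) = 0 := by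
        apply MulChar.map_nonunit
        rwa [ZMod.isUnit_iff_coprime]
      rw [hz]
      by_cases hcr : n.Coprime r
      · have hcq : ¬ n.Coprime q := fun h => hc (by rw [hr]; exact h.mul_right hcr)
        have hz : ψ (n : ZMod q) = 0 := by
          apply MulChar.map_nonunit
          rwa [ZMod.isUnit_iff_coprime]
        rw [hz, mul_zero]
      · rw [if_neg hcr]; simp
  have hr0 : r ≠ 0 := by rintro rfl; simp at hr; omega
  have hmain : ‖∑ n ∈ Finset.Icc 1 N, χ (n : ZMod m)‖ ≤ r.divisors.card * B := by
    have e : ∑ n ∈ Finset.Icc 1 N, χ (n : ZMod m) = ∑ n ∈ Finset.Icc 1 N, ∑ d ∈ n.divisors,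
        ((μ d : ℂ) * ψ (d : ZMod q)) * ψ ((n / d : ℕ) : ZMod q) :=
      Finset.sum_congr rfl fun n hn => hval n (by rw [Finset.mem_Icc] at hn; omega)
    rw [e, conv_sum N (fun d k => ((μ d : ℂ) * ψ (d : ZMod q)) * ψ (k : ZMod q))]
    calc _ ≤ ∑ d ∈ Finset.Icc 1 N, (if d ∣ r then 1 else 0) * B := by
          refine norm_sum_le_of_le _ fun d hd => ?_
          rw [← Finset.mul_sum, norm_mul, norm_mul, Complex.norm_real, Real.norm_eq_abs]
          gcongr
          · calc _ ≤ (if d ∣ r then (1:ℝ) else 0) * 1 := by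
                  refine mul_le_mul (bb_gcd_abs r d) (DirichletCharacter.norm_le_one _ _)
                    (norm_nonneg _) ?_
                  split_ifs <;> simp
              _ = _ := mul_one _
          · exact hB _
      _ = (((Finset.Icc 1 N).filter (· ∣ r)).card : ℝ) * B := by
          rw [← Finset.sum_mul, Finset.sum_boole]
      _ ≤ _ := by
          gcongr
          intro d hd
          simp at hd ⊢
          exact ⟨hd.2, hr0⟩
  have hq2 : (2 : ℝ) ≤ q := by exact_mod_cast (show 2 ≤ q by omega)
  have hqm' : (q : ℝ) ≤ m := by exact_mod_cast Nat.le_of_dvd hm (Dvd.intro _ hr.symm)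
  have hl1 : Real.log 2 ≤ Real.log q := Real.log_le_log (by norm_num) hq2
  have hl2 : Real.log q ≤ Real.log m := Real.log_le_log (by linarith) hqm'
  calc _ ≤ r.divisors.card * B := hmain
    _ ≤ (2 * √r) * (√q * (3 * Real.log m)) := by
        have := log2_low
        have h3 : B ≤ √q * (3 * Real.log m) := by
          apply mul_le_mul_of_nonneg_left _ (Real.sqrt_nonneg _)
          linarith
        exact mul_le_mul (card_div_le r) h3 hB0 (by positivity)
    _ = 6 * (√q * √r) * Real.log m := by ring
    _ = _ := by
        rw [← Real.sqrt_mul (by positivity), ← Nat.cast_mul, ← hr]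

lemma abel_ineq (a : ℕ → ℂ) (w : ℕ → ℝ) (B : ℝ) (hB : ∀ M : ℕ, ‖∑ n ∈ Finset.Icc 1 M, a n‖ ≤ B)
    (hw0 : ∀ n, 0 ≤ w n) (hw : ∀ n, 1 ≤ n → w (n + 1) ≤ w n) (N M : ℕ) (hNM : N ≤ M) :
    ‖∑ n ∈ Finset.Ioc N M, (w n : ℂ) * a n‖ ≤ 2 * B * w (N + 1) := by
  set S : ℕ → ℂ := fun M => ∑ n ∈ Finset.Icc 1 M, a n with hS
  have hS1 : ∀ M, S (M + 1) = S M + a (M + 1) := fun M => by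
    simp only [hS]; rw [Finset.sum_Icc_succ_top (by omega)]
  have hSd : ∀ M, ‖S M - S N‖ ≤ 2 * B := fun M => by
    have := (norm_sub_le (S M) (S N)).trans (add_le_add (hB M) (hB N)); linarith
  have key : ‖∑ n ∈ Finset.Ioc N M, (w n : ℂ) * a n - (w (M + 1) : ℂ) * (S M - S N)‖ ≤
      2 * B * (w (N + 1) - w (M + 1)) := by
    induction M, hNM using Nat.le_induction with
    | base => simp
    | succ M hM ih =>
      rw [Finset.sum_Ioc_succ_top hM]
      have e : ∑ n ∈ Finset.Ioc N M, (w n : ℂ) * a n + (w (M + 1) : ℂ) * a (M + 1)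
          - (w (M + 1 + 1) : ℂ) * (S (M + 1) - S N) =
          (∑ n ∈ Finset.Ioc N M, (w n : ℂ) * a n - (w (M + 1) : ℂ) * (S M - S N)) +
          ((w (M + 1) - w (M + 1 + 1) : ℝ) : ℂ) * (S (M + 1) - S N) := by
        rw [hS1]; push_cast; ring
      rw [e]
      refine (norm_add_le _ _).trans ?_
      have h2 : ‖((w (M + 1) - w (M + 1 + 1) : ℝ) : ℂ) * (S (M + 1) - S N)‖ ≤
          (w (M + 1) - w (M + 1 + 1)) * (2 * B) := by
        have h0 : 0 ≤ w (M + 1) - w (M + 1 + 1) := by linarith [hw (M + 1) (by omega)]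
        rw [norm_mul, Complex.norm_real, Real.norm_eq_abs, abs_of_nonneg h0]
        gcongr
        exact hSd _
      linarith
  have h3 : ‖(w (M + 1) : ℂ) * (S M - S N)‖ ≤ w (M + 1) * (2 * B) := by
    rw [norm_mul, Complex.norm_real, Real.norm_eq_abs, abs_of_nonneg (hw0 _)]
    gcongr
    · exact hw0 _
    · exact hSd _
  have h4 := norm_add_le (∑ n ∈ Finset.Ioc N M, (w n : ℂ) * a n - (w (M + 1) : ℂ) * (S M - S N))
    ((w (M + 1) : ℂ) * (S M - S N))
  rw [sub_add_cancel] at h4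
  linarith

open Filter Topology in
lemma L_one {m : ℕ} [NeZero m] (χ : DirichletCharacter ℂ m) (hχ : χ ≠ 1) (B : ℝ)
    (hB : ∀ M : ℕ, ‖∑ n ∈ Finset.Icc 1 M, χ (n : ZMod m)‖ ≤ B) (N : ℕ) :
    ‖∑ n ∈ Finset.Icc 1 N, χ (n : ZMod m) / (n : ℂ) - DirichletCharacter.LFunction χ 1‖ ≤
      2 * B / (N + 1) := by
  have hB0 : 0 ≤ B := (norm_nonneg _).trans (hB 0)
  have h1 : ∀ s : ℝ, 1 < s → ‖∑ n ∈ Finset.Icc 1 N, χ (n : ZMod m) / (n : ℂ) ^ (s : ℂ) -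
      DirichletCharacter.LFunction χ s‖ ≤ 2 * B / (N + 1) := by
    intro s hs
    have hs' : 1 < (s : ℂ).re := by simpa using hs
    rw [DirichletCharacter.LFunction_eq_LSeries χ hs']
    have hsum := (DirichletCharacter.LSeriesSummable_of_one_lt_re χ hs').hasSum.tendsto_sum_nat
    have hsum' := hsum.comp (tendsto_add_atTop_nat 1)
    have hterm : ∀ M, ∑ n ∈ Finset.range (M + 1), LSeries.term (fun n => χ (n : ZMod m)) s n =
        ∑ n ∈ Finset.Icc 1 M, χ (n : ZMod m) / (n : ℂ) ^ (s : ℂ) := by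
      intro M
      rw [Finset.range_eq_Ico, Finset.sum_eq_sum_Ico_succ_bot (Nat.succ_pos M)]
      simp only [LSeries.term_zero, zero_add]
      refine Finset.sum_congr rfl fun n hn => ?_
      rw [LSeries.term_of_ne_zero (by simp at hn; omega)]
    have hlim := ((tendsto_const_nhds (x := ∑ n ∈ Finset.Icc 1 N, χ (n : ZMod m) / (n : ℂ) ^ (s : ℂ))).sub hsum').norm
    refine le_of_tendsto hlim ?_
    filter_upwards [eventually_ge_atTop N] with M hM
    simp only [Function.comp]
    rw [hterm, norm_sub_rev]
    have hsplit : ∑ n ∈ Finset.Icc 1 M, χ (n : ZMod m) / (n : ℂ) ^ (s : ℂ) -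
        ∑ n ∈ Finset.Icc 1 N, χ (n : ZMod m) / (n : ℂ) ^ (s : ℂ) =
        ∑ n ∈ Finset.Ioc N M, (((n : ℝ) ^ (-s) : ℝ) : ℂ) * χ (n : ZMod m) := by
      have hd : Finset.Icc 1 M = Finset.Icc 1 N ∪ Finset.Ioc N M := by
        ext n; simp only [Finset.mem_union, Finset.mem_Icc, Finset.mem_Ioc]; omega
      have hdis : Disjoint (Finset.Icc 1 N) (Finset.Ioc N M) := by
        rw [Finset.disjoint_left]; intro n; simp only [Finset.mem_Icc, Finset.mem_Ioc]; omega
      rw [hd, Finset.sum_union hdis, add_sub_cancel_left]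
      refine Finset.sum_congr rfl fun n _ => ?_
      rw [Complex.ofReal_cpow (by positivity)]
      push_cast
      rw [Complex.cpow_neg, div_eq_mul_inv, mul_comm]
    rw [hsplit]
    refine (abel_ineq (fun n => χ (n : ZMod m)) (fun n => (n : ℝ) ^ (-s)) B hB
      (fun n => by positivity) ?_ N M hM).trans ?_
    · intro n hn
      have : (0 : ℝ) < n := by exact_mod_cast hn
      exact Real.rpow_le_rpow_of_nonpos this (by push_cast; linarith) (by linarith)
    · rw [div_eq_mul_inv]
      gcongr
      rw [← Real.rpow_neg_one]
      push_cast
      exact Real.rpow_le_rpow_of_exponent_le (by linarith [(Nat.cast_nonneg N : (0:ℝ) ≤ N)]) (by linarith)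
  have hcont : Continuous fun s : ℝ => ‖∑ n ∈ Finset.Icc 1 N, χ (n : ZMod m) / (n : ℂ) ^ (s : ℂ) -
      DirichletCharacter.LFunction χ s‖ := by
    refine Continuous.norm (Continuous.sub ?_ ?_)
    · refine continuous_finsetSum _ fun n hn => ?_
      have hn0 : (n : ℂ) ≠ 0 := by
        simp at hn; exact_mod_cast (by omega : n ≠ 0)
      have : NeZero (n : ℂ) := ⟨hn0⟩
      refine Continuous.div continuous_const ?_ ?_
      · exact (continuous_const_cpow (z := (n : ℂ))).comp Complex.continuous_ofReal
      · intro s; simp [Complex.cpow_eq_zero_iff, hn0]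
    · exact (DirichletCharacter.differentiable_LFunction hχ).continuous.comp Complex.continuous_ofReal
  have ht : Tendsto (fun s : ℝ => ‖∑ n ∈ Finset.Icc 1 N, χ (n : ZMod m) / (n : ℂ) ^ (s : ℂ) -
      DirichletCharacter.LFunction χ s‖) (𝓝[>] 1) (𝓝 _) := (hcont.tendsto 1).mono_left nhdsWithin_le_nhds
  have := le_of_tendsto ht (eventually_nhdsWithin_of_forall fun s hs => h1 s hs)
  simpa using this

lemma head_conv (u v : ℕ → ℝ) (V : ℝ) (N : ℕ) (hu : ∀ e, 0 ≤ u e)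
    (hV : ∀ C, C ≤ N → ∑ k ∈ Finset.Icc 1 C, v k ≤ V) :
    ∑ n ∈ Finset.Icc 1 N, ∑ d ∈ n.divisors, u d * v (n / d) ≤ (∑ e ∈ Finset.Icc 1 N, u e) * V := by
  rw [conv_sum N (fun d k => u d * v k), Finset.sum_mul]
  refine Finset.sum_le_sum fun d _ => ?_
  rw [← Finset.mul_sum]
  exact mul_le_mul_of_nonneg_left (hV _ (Nat.div_le_self _ _)) (hu _)

lemma tail_conv (u v : ℕ → ℝ) (c : ℝ) (hc : 0 ≤ c) (M N : ℕ) (hu : ∀ e, 0 ≤ u e)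
    (hV : ∀ A C : ℕ, ∑ k ∈ Finset.Ioc A C, v k ≤ c / (A + 1)) :
    ∑ n ∈ Finset.Ioc M N, ∑ d ∈ n.divisors, u d * v (n / d) ≤
      (∑ e ∈ Finset.Icc 1 N, e * u e) * (c / (M + 1)) := by
  have e1 : Finset.Ioc M N = (Finset.Icc 1 N).filter (fun n => M < n) := by
    ext n; simp only [Finset.mem_filter, Finset.mem_Icc, Finset.mem_Ioc]; omega
  have e2 : ∑ n ∈ Finset.Ioc M N, ∑ d ∈ n.divisors, u d * v (n / d) =
      ∑ n ∈ Finset.Icc 1 N, ∑ d ∈ n.divisors, if M < d * (n / d) then u d * v (n / d) else 0 := by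
    rw [e1, Finset.sum_filter]
    refine Finset.sum_congr rfl fun n _ => ?_
    have : ∀ d ∈ n.divisors, (if M < d * (n / d) then u d * v (n / d) else 0) =
      if M < n then u d * v (n / d) else 0 := fun d hd => by
        rw [Nat.mul_div_cancel' (Nat.dvd_of_mem_divisors hd)]
    rw [Finset.sum_congr rfl this]
    split_ifs <;> simp
  rw [e2, conv_sum N (fun d k => if M < d * k then u d * v k else 0), Finset.sum_mul]
  refine Finset.sum_le_sum fun d hd => ?_
  have hd0 : 0 < d := by simp at hd; omega
  rw [← Finset.sum_filter]
  have e3 : (Finset.Icc 1 (N / d)).filter (fun k => M < d * k) = Finset.Ioc (M / d) (N / d) := by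
    ext k
    simp only [Finset.mem_filter, Finset.mem_Icc, Finset.mem_Ioc]
    rw [Nat.div_lt_iff_lt_mul hd0, mul_comm d k]
    constructor
    · rintro ⟨⟨a, b⟩, c⟩; exact ⟨c, b⟩
    · rintro ⟨a, b⟩
      exact ⟨⟨Nat.pos_of_ne_zero (by rintro rfl; simp at a), b⟩, a⟩
  rw [e3, ← Finset.mul_sum]
  have hd' : (0 : ℝ) < d := by exact_mod_cast hd0
  have hlt : (M : ℝ) + 1 ≤ d * (((M / d : ℕ) : ℝ) + 1) := by
    exact_mod_cast Nat.lt_mul_div_succ M hd0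
  calc _ ≤ u d * (c / (((M / d : ℕ) : ℝ) + 1)) := mul_le_mul_of_nonneg_left (hV _ _) (hu _)
    _ = d * u d * (c / (d * (((M / d : ℕ) : ℝ) + 1))) := by field_simp
    _ ≤ _ := by
      have := hu d
      gcongr

noncomputable def gam (p : ℕ) : ℝ := 1 / ((p : ℝ) - 1)
noncomputable def bet (f : ℕ) (p : ℕ) : ℝ := if p ∣ f then -1 else 1 / ((p : ℝ) - 1)

lemma gam_pos {p : ℕ} (hp : p.Prime) : 0 < gam p := by
  have : (1 : ℝ) < p := by exact_mod_cast hp.one_lt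
  unfold gam; have : 0 < (p : ℝ) - 1 := by linarith
  positivity

lemma bbg_nonneg (d : ℕ) : 0 ≤ bb gam d := by
  unfold bb; split_ifs
  · exact Finset.prod_nonneg fun p hp => (gam_pos (Nat.prime_of_mem_primeFactors hp)).le
  · rfl

lemma prod_gam {n : ℕ} (hn : n ≠ 0) :
    ∏ p ∈ n.primeFactors, (1 + gam p) = n / n.totient := by
  have h := congrArg (fun q : ℚ => (q : ℝ)) (Nat.totient_eq_mul_prod_factors n)
  push_cast at h
  have hn' : (n : ℝ) ≠ 0 := by exact_mod_cast hn
  have ht : (n.totient : ℝ) ≠ 0 := by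
    have := Nat.totient_pos.2 (Nat.pos_of_ne_zero hn); exact_mod_cast this.ne'
  have hprod : (∏ p ∈ n.primeFactors, (1 + gam p)) * ∏ p ∈ n.primeFactors, (1 - (p : ℝ)⁻¹) = 1 := by
    rw [← Finset.prod_mul_distrib]
    refine Finset.prod_eq_one fun p hp => ?_
    have : (1 : ℝ) < p := by exact_mod_cast (Nat.prime_of_mem_primeFactors hp).one_lt
    have h1 : (p : ℝ) - 1 ≠ 0 := by linarith
    have h2 : (p : ℝ) ≠ 0 := by linarith
    unfold gam
    field_simp
    ring
  rw [eq_div_iff ht, h]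
  linear_combination (n : ℝ) * hprod

lemma bbg_sum {n : ℕ} (hn : n ≠ 0) : ∑ d ∈ n.divisors, bb gam d = n / n.totient := by
  rw [bb_sum _ hn, prod_gam hn]

lemma bbb_sum {f : ℕ} {n : ℕ} (hn : n ≠ 0) : ∑ d ∈ n.divisors, bb (bet f) d =
    if n.Coprime f then (n : ℝ) / n.totient else 0 := by
  rw [bb_sum _ hn]
  split_ifs with h
  · rw [← prod_gam hn]
    refine Finset.prod_congr rfl fun p hp => ?_
    have hp' := Nat.prime_of_mem_primeFactors hp
    have : ¬ p ∣ f := fun hr => hp'.one_lt.ne' (Nat.eq_one_of_dvd_coprimes h (Nat.dvd_of_mem_primeFactors hp) hr)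
    simp [bet, gam, this]
  · obtain ⟨p, hp, h1, h2⟩ := Nat.Prime.not_coprime_iff_dvd.1 h
    exact Finset.prod_eq_zero (Nat.mem_primeFactors.2 ⟨hp, h1, hn⟩) (by simp [bet, h2])

lemma bbg_le {d : ℕ} (hd : d ≠ 0) : bb gam d ≤ 1 / d.totient := by
  have ht : (0 : ℝ) < d.totient := by
    have := Nat.totient_pos.2 (Nat.pos_of_ne_zero hd); exact_mod_cast this
  unfold bb
  split_ifs with h
  · have h1 := prod_gam hd
    have h2 : ∏ p ∈ d.primeFactors, (1 + gam p) = (∏ p ∈ d.primeFactors, gam p) * d := by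
      conv_rhs => rw [← Nat.prod_primeFactors_of_squarefree h]
      rw [Nat.primeFactors_prod (fun p hp => Nat.prime_of_mem_primeFactors hp)]
      push_cast
      rw [← Finset.prod_mul_distrib]
      refine Finset.prod_congr rfl fun p hp => ?_
      have : (1 : ℝ) < p := by exact_mod_cast (Nat.prime_of_mem_primeFactors hp).one_lt
      have h1 : (p : ℝ) - 1 ≠ 0 := by linarith
      unfold gam; field_simp; ring
    rw [h2] at h1
    have hd' : (d : ℝ) ≠ 0 := by exact_mod_cast hd
    apply le_of_eq
    have := mul_right_cancel₀ hd' (h1.trans (by ring : (d : ℝ) / d.totient = 1 / d.totient * d))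
    exact this
  · positivity

lemma bbb_abs {f : ℕ} {d : ℕ} (hd : d ≠ 0) :
    |bb (bet f) d| ≤ ∑ e ∈ d.divisors, (if e ∣ f then (1:ℝ) else 0) * (1 / ((d / e).totient : ℝ)) := by
  by_cases h : Squarefree d
  · obtain ⟨k, hk⟩ := Nat.gcd_dvd_left d f
    set e := d.gcd f with he
    have hef : e ∣ f := Nat.gcd_dvd_right d f
    have he0 : 0 < e := Nat.gcd_pos_of_pos_left _ (Nat.pos_of_ne_zero hd)
    have hk0 : k ≠ 0 := by rintro rfl; simp at hk; omega
    have hcop : e.Coprime k := by rw [hk] at h; exact Nat.coprime_of_squarefree_mul h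
    have hsq : Squarefree k := h.squarefree_of_dvd (Dvd.intro_left _ hk.symm)
    have hsqe : Squarefree e := h.squarefree_of_dvd (Dvd.intro _ hk.symm)
    have h1 : |bb (bet f) d| = bb gam k := by
      rw [hk, bb_mul _ hcop, abs_mul]
      have ha : |bb (bet f) e| = 1 := by
        unfold bb
        rw [if_pos hsqe, Finset.abs_prod]
        refine Finset.prod_eq_one fun p hp => ?_
        simp [bet, (Nat.dvd_of_mem_primeFactors hp).trans hef]
      have hb : bb (bet f) k = bb gam k := by
        unfold bb
        rw [if_pos hsq, if_pos hsq]
        refine Finset.prod_congr rfl fun p hp => ?_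
        have hpk := Nat.dvd_of_mem_primeFactors hp
        have : ¬ p ∣ f := fun hpf => by
          have hpe : p ∣ e := Nat.dvd_gcd (hpk.trans (Dvd.intro_left _ hk.symm)) hpf
          exact (Nat.prime_of_mem_primeFactors hp).one_lt.ne' (Nat.eq_one_of_dvd_coprimes hcop hpe hpk)
        simp [bet, gam, this]
      rw [ha, hb, one_mul, abs_of_nonneg (bbg_nonneg _)]
    rw [h1]
    refine (bbg_le hk0).trans ?_
    have hmem : e ∈ d.divisors := Nat.mem_divisors.2 ⟨Dvd.intro _ hk.symm, hd⟩
    refine le_trans (le_of_eq ?_) (Finset.single_le_sum (f := fun e => (if e ∣ f then (1:ℝ) else 0) * (1 / ((d / e).totient : ℝ))) (fun i _ => ?_) hmem)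
    · have : d / e = k := by rw [hk, Nat.mul_div_cancel_left _ he0]
      simp only [this, if_pos hef, one_mul]
    · split_ifs <;> positivity
  · unfold bb
    rw [if_neg h, abs_zero]
    refine Finset.sum_nonneg fun i _ => ?_
    split_ifs <;> positivity

lemma bbg_bound (N : ℕ) : ∑ e ∈ Finset.Icc 1 N, bb gam e / e ≤ 3 := by
  set P := (Finset.Icc 1 N).filter Nat.Prime with hP
  have hpr : ∀ p ∈ P, p.Prime := fun p hp => (Finset.mem_filter.1 hp).2
  have hg : ∀ p ∈ P, 0 ≤ gam p / p := fun p hp => div_nonneg (gam_pos (hpr p hp)).le (by positivity)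
  have h1 : ∑ e ∈ Finset.Icc 1 N, bb gam e / e ≤ ∑ t ∈ P.powerset, ∏ p ∈ t, gam p / p := by
    have e1 : ∑ e ∈ Finset.Icc 1 N, bb gam e / e =
        ∑ e ∈ (Finset.Icc 1 N).filter Squarefree, ∏ p ∈ e.primeFactors, gam p / p := by
      rw [Finset.sum_filter]
      refine Finset.sum_congr rfl fun e _ => ?_
      unfold bb
      split_ifs with h
      · rw [Finset.prod_div_distrib]
        congr 1
        rw [← Nat.cast_prod, Nat.prod_primeFactors_of_squarefree h]
      · simp
    rw [e1, ← Finset.sum_image (f := fun t => ∏ p ∈ t, gam p / p) (g := fun e : ℕ => e.primeFactors)]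
    · refine Finset.sum_le_sum_of_subset_of_nonneg ?_ ?_
      · intro t ht
        obtain ⟨e, he, rfl⟩ := Finset.mem_image.1 ht
        simp only [Finset.mem_filter, Finset.mem_Icc] at he
        rw [Finset.mem_powerset]
        intro p hp
        have hp' := Nat.prime_of_mem_primeFactors hp
        have := Nat.le_of_dvd (by omega) (Nat.dvd_of_mem_primeFactors hp)
        simp only [hP, Finset.mem_filter, Finset.mem_Icc]
        exact ⟨⟨hp'.one_le, by omega⟩, hp'⟩
      · intro t ht _
        exact Finset.prod_nonneg fun p hp => hg p (Finset.mem_powerset.1 ht hp)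
    · intro a ha b hb hab
      simp only [Finset.coe_filter, Set.mem_ofPred_eq] at ha hb
      rw [← Nat.prod_primeFactors_of_squarefree ha.2, ← Nat.prod_primeFactors_of_squarefree hb.2]
      exact congrArg (fun s : Finset ℕ => ∏ p ∈ s, p) hab
  rw [← Finset.prod_one_add] at h1
  have hg' : ∀ p : ℕ, 0 ≤ gam p / p := fun p => by
    rcases Nat.eq_zero_or_pos p with h | h
    · simp [h]
    · have : (1 : ℝ) ≤ p := by exact_mod_cast h
      unfold gam
      exact div_nonneg (one_div_nonneg.2 (by linarith)) (by positivity)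
  have h2 := Real.prod_one_add_le_exp_sum P (f := fun p => gam p / p) 
  have h3 : ∑ p ∈ P, gam p / p ≤ 1 := by
    have : ∀ N : ℕ, 1 ≤ N → ∑ p ∈ Finset.Icc 2 N, gam p / p ≤ 1 - 1 / N := by
      intro N hN
      induction N, hN using Nat.le_induction with
      | base => simp
      | succ N hN ih =>
        rw [Finset.sum_Icc_succ_top (by omega)]
        have hN' : (0 : ℝ) < N := by exact_mod_cast hN
        have : gam (N + 1) / ((N + 1 : ℕ) : ℝ) = 1 / N - 1 / ((N + 1 : ℕ) : ℝ) := by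
          unfold gam; push_cast; rw [add_sub_cancel_right]; field_simp; ring
        linarith
    rcases Nat.eq_zero_or_pos N with h0 | h0
    · simp [hP, h0]
    · have hh := this N h0
      have hs : ∑ p ∈ P, gam p / p ≤ ∑ p ∈ Finset.Icc 2 N, gam p / p := by
        refine Finset.sum_le_sum_of_subset_of_nonneg ?_ ?_
        · intro p hp
          have := (hpr p hp).two_le
          simp [hP] at hp; simp; omega
        · intro p hp _
          have : (2 : ℝ) ≤ p := by simp at hp; exact_mod_cast hp.1
          unfold gam
          have : 0 < (p : ℝ) - 1 := by linarith
          positivity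
      have : (0 : ℝ) ≤ 1 / N := by positivity
      linarith
  have h4 : Real.exp (∑ p ∈ P, gam p / p) ≤ 3 := by
    have := Real.exp_le_exp.2 h3
    have := Real.exp_one_lt_d9
    linarith
  exact h1.trans ((h2 hg').trans h4)

lemma inv_tot_sum (N : ℕ) : ∑ k ∈ Finset.Icc 1 N, 1 / (k.totient : ℝ) ≤ 3 * (1 + Real.log N) := by
  have e : ∑ k ∈ Finset.Icc 1 N, 1 / (k.totient : ℝ) = ∑ n ∈ Finset.Icc 1 N, ∑ d ∈ n.divisors,
      (bb gam d / d) * (fun k : ℕ => 1 / (k : ℝ)) (n / d) := by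
    refine Finset.sum_congr rfl fun n hn => ?_
    have hn0 : n ≠ 0 := by simp at hn; omega
    have hn' : (n : ℝ) ≠ 0 := by exact_mod_cast hn0
    have h1 : ∀ d ∈ n.divisors, (bb gam d / d) * (fun k : ℕ => 1 / (k : ℝ)) (n / d) = bb gam d / n := by
      intro d hd
      have hdn := Nat.dvd_of_mem_divisors hd
      have hd0 : (d : ℝ) ≠ 0 := by
        have := Nat.pos_of_mem_divisors hd; exact_mod_cast this.ne'
      simp only [Nat.cast_div hdn hd0]
      field_simp
    rw [Finset.sum_congr rfl h1, ← Finset.sum_div, bbg_sum hn0]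
    field_simp
  rw [e]
  have hl : 0 ≤ Real.log N := Real.log_natCast_nonneg N
  refine (head_conv (fun d => bb gam d / d) (fun k : ℕ => 1 / (k : ℝ)) (1 + Real.log N) N (fun e => div_nonneg (bbg_nonneg e) (by positivity)) ?_).trans ?_
  · intro C hC
    refine le_trans ?_ (harm N)
    exact Finset.sum_le_sum_of_subset_of_nonneg (Finset.Icc_subset_Icc_right hC) fun i _ _ => by positivity
  · exact mul_le_mul_of_nonneg_right (bbg_bound N) (by linarith)

lemma inv_tot_tail (M N : ℕ) : ∑ k ∈ Finset.Ioc M N, 1 / ((k : ℝ) * k.totient) ≤ 6 / (M + 1) := by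
  have e : ∑ k ∈ Finset.Ioc M N, 1 / ((k : ℝ) * k.totient) = ∑ n ∈ Finset.Ioc M N, ∑ d ∈ n.divisors,
      (bb gam d / d ^ 2) * (fun k : ℕ => ((k : ℝ) ^ 2)⁻¹) (n / d) := by
    refine Finset.sum_congr rfl fun n hn => ?_
    have hn0 : n ≠ 0 := by simp at hn; omega
    have hn' : (n : ℝ) ≠ 0 := by exact_mod_cast hn0
    have h1 : ∀ d ∈ n.divisors, (bb gam d / d ^ 2) * (fun k : ℕ => ((k : ℝ) ^ 2)⁻¹) (n / d) = bb gam d / n ^ 2 := by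
      intro d hd
      have hdn := Nat.dvd_of_mem_divisors hd
      have hd0 : (d : ℝ) ≠ 0 := by
        have := Nat.pos_of_mem_divisors hd; exact_mod_cast this.ne'
      simp only [Nat.cast_div hdn hd0]
      field_simp
    rw [Finset.sum_congr rfl h1, ← Finset.sum_div, bbg_sum hn0]
    field_simp
  rw [e]
  refine (tail_conv (fun d => bb gam d / d ^ 2) (fun k : ℕ => ((k : ℝ) ^ 2)⁻¹) 2 (by norm_num) M N (fun e => div_nonneg (bbg_nonneg e) (by positivity)) ?_).trans ?_
  · intro A C
    have := sum_Ioo_inv_sq_le (α := ℝ) A (C + 1)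
    have e : Finset.Ioc A C = Finset.Ioo A (C + 1) := by
      ext; simp only [Finset.mem_Ioc, Finset.mem_Ioo]; omega
    rw [e]; exact this
  · have h1 : ∑ e ∈ Finset.Icc 1 N, (e : ℝ) * (bb gam e / e ^ 2) = ∑ e ∈ Finset.Icc 1 N, bb gam e / e := by
      refine Finset.sum_congr rfl fun n hn => ?_
      have hn' : (n : ℝ) ≠ 0 := by simp at hn; exact_mod_cast (by omega : n ≠ 0)
      field_simp
    rw [h1]
    calc _ ≤ 3 * (2 / ((M : ℝ) + 1)) := mul_le_mul_of_nonneg_right (bbg_bound N) (by positivity)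
      _ = _ := by ring

lemma sum_dvd_le {f : ℕ} (hf : f ≠ 0) (N : ℕ) :
    ∑ e ∈ Finset.Icc 1 N, (if e ∣ f then (1:ℝ) else 0) ≤ f.divisors.card := by
  rw [Finset.sum_boole]
  gcongr
  intro d hd
  simp at hd ⊢
  exact ⟨hd.2, hf⟩

lemma b_head {f : ℕ} (hf : f ≠ 0) (N : ℕ) :
    ∑ d ∈ Finset.Icc 1 N, |bb (bet f) d| ≤ f.divisors.card * (3 * (1 + Real.log N)) := by
  have hl : 0 ≤ Real.log N := Real.log_natCast_nonneg N
  calc _ ≤ ∑ n ∈ Finset.Icc 1 N, ∑ d ∈ n.divisors, (if d ∣ f then (1:ℝ) else 0) *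
        (fun k : ℕ => 1 / (k.totient : ℝ)) (n / d) :=
        Finset.sum_le_sum fun d hd => bbb_abs (by simp at hd; omega)
    _ ≤ (∑ e ∈ Finset.Icc 1 N, (if e ∣ f then (1:ℝ) else 0)) * (3 * (1 + Real.log N)) := by
        refine head_conv (fun e => if e ∣ f then (1:ℝ) else 0) (fun k : ℕ => 1 / (k.totient : ℝ)) _ N (fun e => by split_ifs <;> simp) ?_
        intro C hC
        refine le_trans ?_ (inv_tot_sum N)
        exact Finset.sum_le_sum_of_subset_of_nonneg (Finset.Icc_subset_Icc_right hC) fun i _ _ => by positivity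
    _ ≤ _ := mul_le_mul_of_nonneg_right (sum_dvd_le hf N) (by linarith)

lemma b_tail {f : ℕ} (hf : f ≠ 0) (M N : ℕ) :
    ∑ d ∈ Finset.Ioc M N, |bb (bet f) d| / d ≤ f.divisors.card * (6 / (M + 1)) := by
  calc _ ≤ ∑ n ∈ Finset.Ioc M N, ∑ d ∈ n.divisors, ((if d ∣ f then (1:ℝ) else 0) / d) *
        (fun k : ℕ => 1 / ((k : ℝ) * k.totient)) (n / d) := by
        refine Finset.sum_le_sum fun n hn => ?_
        have hn0 : n ≠ 0 := by simp at hn; omega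
        have hn' : (n : ℝ) ≠ 0 := by exact_mod_cast hn0
        refine (div_le_div_of_nonneg_right (bbb_abs hn0) (by positivity)).trans (le_of_eq ?_)
        rw [Finset.sum_div]
        refine Finset.sum_congr rfl fun d hd => ?_
        have hdn := Nat.dvd_of_mem_divisors hd
        have hd0 : (d : ℝ) ≠ 0 := by
          have := Nat.pos_of_mem_divisors hd; exact_mod_cast this.ne'
        simp only [Nat.cast_div hdn hd0]
        field_simp
    _ ≤ (∑ e ∈ Finset.Icc 1 N, e * ((if e ∣ f then (1:ℝ) else 0) / e)) * (6 / (M + 1)) := by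
        refine tail_conv (fun e => (if e ∣ f then (1:ℝ) else 0) / e)
          (fun k : ℕ => 1 / ((k : ℝ) * k.totient)) 6 (by norm_num) M N
          (fun e => by split_ifs <;> positivity) ?_
        intro A C
        exact inv_tot_tail A C
    _ = (∑ e ∈ Finset.Icc 1 N, (if e ∣ f then (1:ℝ) else 0)) * (6 / (M + 1)) := by
        congr 1
        refine Finset.sum_congr rfl fun n hn => ?_
        have hn' : (n : ℝ) ≠ 0 := by simp at hn; exact_mod_cast (by omega : n ≠ 0)
        field_simp
    _ ≤ _ := mul_le_mul_of_nonneg_right (sum_dvd_le hf N) (by positivity)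

noncomputable def hh {m : ℕ} (χ : DirichletCharacter ℂ m) (f d : ℕ) : ℂ :=
  (bb (bet f) d : ℂ) * χ (d : ZMod m) / d

lemma hh_norm {m : ℕ} (χ : DirichletCharacter ℂ m) (f d : ℕ) : ‖hh χ f d‖ ≤ |bb (bet f) d| / d := by
  unfold hh
  rw [norm_div, norm_mul, Complex.norm_real, Real.norm_eq_abs, Complex.norm_natCast]
  gcongr
  calc _ ≤ |bb (bet f) d| * 1 := by
        gcongr; exact DirichletCharacter.norm_le_one _ _
    _ = _ := mul_one _

lemma hh_summable {m : ℕ} (χ : DirichletCharacter ℂ m) {f : ℕ} (hf : f ≠ 0) :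
    Summable fun d => ‖hh χ f d‖ := by
  refine summable_of_sum_range_le (c := f.divisors.card * 6) (fun _ => norm_nonneg _) fun n => ?_
  have h0 : ‖hh χ f 0‖ = 0 := by simp [hh]
  calc ∑ i ∈ Finset.range n, ‖hh χ f i‖ ≤ ∑ i ∈ Finset.range (n + 1), ‖hh χ f i‖ :=
        Finset.sum_le_sum_of_subset_of_nonneg (Finset.range_mono (by omega)) fun _ _ _ => norm_nonneg _
    _ = ∑ i ∈ Finset.Ioc 0 n, ‖hh χ f i‖ := by
        rw [Finset.range_eq_Ico, Finset.sum_eq_sum_Ico_succ_bot (Nat.succ_pos n), h0, zero_add]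
        rfl
    _ ≤ ∑ i ∈ Finset.Ioc 0 n, |bb (bet f) i| / i := Finset.sum_le_sum fun i _ => hh_norm χ f i
    _ ≤ _ := by simpa using b_tail hf 0 n

lemma hh_tsum {m : ℕ} (χ : DirichletCharacter ℂ m) {f : ℤ} (hf : f ≠ 0) :
    cChi χ f = ∑' d, hh χ f.natAbs d := by
  have hf' : f.natAbs ≠ 0 := by simpa using hf
  have h1 : hh χ f.natAbs 1 = 1 := by simp [hh, bb_one]
  have hmul : ∀ {a b : ℕ}, a.Coprime b → hh χ f.natAbs (a * b) = hh χ f.natAbs a * hh χ f.natAbs b := by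
    intro a b hab
    unfold hh
    rw [bb_mul _ hab]
    push_cast
    rw [map_mul]
    ring
  rw [← EulerProduct.eulerProduct_tprod h1 hmul (hh_summable χ hf') (by simp [hh])]
  unfold cChi
  refine tprod_congr fun p => ?_
  have hp := p.2
  have hpow : ∀ e ∉ Finset.range 2, hh χ f.natAbs ((p : ℕ) ^ e) = 0 := by
    intro e he
    have he2 : 2 ≤ e := by
      rw [Finset.mem_range] at he; omega
    have : ¬ Squarefree ((p : ℕ) ^ e) := by
      intro hs
      have := (Nat.squarefree_pow_iff hp.one_lt.ne' (by omega)).1 hs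
      omega
    simp [hh, bb, this]
  rw [tsum_eq_sum hpow, Finset.sum_range_succ, Finset.sum_range_one, pow_zero, pow_one, h1]
  have hb : bb (bet f.natAbs) p = bet f.natAbs p := by
    simp [bb, hp.squarefree, hp.primeFactors]
  unfold hh
  rw [hb]
  have hiff : ((p : ℕ) : ℤ) ∣ f ↔ (p : ℕ) ∣ f.natAbs := Int.natCast_dvd
  by_cases h : (p : ℕ) ∣ f.natAbs
  · rw [if_pos (hiff.2 h)]
    simp [bet, h]; ring
  · rw [if_neg (fun h' => h (hiff.1 h'))]
    simp only [bet, h, if_false]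
    push_cast
    congr 1
    rw [div_eq_mul_inv, mul_inv, one_div]
    ring

lemma main_nat {m : ℕ} (hm : 0 < m) (χ : DirichletCharacter ℂ m) (hχ : χ ≠ 1) (f : ℤ) (hf : f ≠ 0)
    (B : ℝ) (hB : ∀ M : ℕ, ‖∑ n ∈ Finset.Icc 1 M, χ (n : ZMod m)‖ ≤ B) (N : ℕ) :
    ‖(∑ n ∈ (Finset.Icc 1 N).filter (fun n : ℕ => Int.gcd (n : ℤ) f = 1),
          χ ((n : ℕ) : ZMod m) / (n.totient : ℂ)) - Lone χ * cChi χ f‖ ≤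
        B * f.natAbs.divisors.card * (18 + 6 * Real.log N) / (N + 1) ∧
      ‖∑ n ∈ (Finset.Icc 1 N).filter (fun n : ℕ => Int.gcd (n : ℤ) f = 1),
          χ ((n : ℕ) : ZMod m) * (n : ℂ) / (n.totient : ℂ)‖ ≤
        B * f.natAbs.divisors.card * (3 * (1 + Real.log N)) := by
  have : NeZero m := ⟨hm.ne'⟩
  have hf' : f.natAbs ≠ 0 := by simpa using hf
  have hB0 : 0 ≤ B := (norm_nonneg _).trans (hB 0)
  set F := f.natAbs with hF
  have hgcd : ∀ n : ℕ, Int.gcd (n : ℤ) f = 1 ↔ n.Coprime F := fun n => by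
    rw [Int.gcd_def]; simp [Nat.Coprime, hF]
  have hbsum : ∀ n : ℕ, n ≠ 0 → (∑ d ∈ n.divisors, (bb (bet F) d : ℂ)) =
      if Int.gcd (n : ℤ) f = 1 then (n : ℂ) / n.totient else 0 := by
    intro n hn
    have := congrArg (fun r : ℝ => (r : ℂ)) (bbb_sum (f := F) hn)
    simp only [hgcd]
    push_cast at this
    rw [this]
    split_ifs <;> simp
  constructor
  · set L := Lone χ with hL
    have hLe : L = DirichletCharacter.LFunction χ 1 := by
      rw [hL, Lone, dif_pos hm.ne']
    have hL1 : ∀ M : ℕ, ‖∑ n ∈ Finset.Icc 1 M, χ (n : ZMod m) / (n : ℂ) - L‖ ≤ 2 * B / (M + 1) := by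
      intro M; rw [hLe]; exact L_one χ hχ B hB M
    have hLn : ‖L‖ ≤ 2 * B := by simpa using hL1 0
    have e1 : ∑ n ∈ (Finset.Icc 1 N).filter (fun n : ℕ => Int.gcd (n : ℤ) f = 1),
          χ ((n : ℕ) : ZMod m) / (n.totient : ℂ) =
        ∑ d ∈ Finset.Icc 1 N, hh χ F d * ∑ k ∈ Finset.Icc 1 (N / d), χ (k : ZMod m) / (k : ℂ) := by
      simp only [Finset.mul_sum]
      rw [← conv_sum N (fun d k => hh χ F d * (χ (k : ZMod m) / (k : ℂ))), Finset.sum_filter]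
      refine Finset.sum_congr rfl fun n hn => ?_
      have hn0 : n ≠ 0 := by simp at hn; omega
      have hn' : (n : ℂ) ≠ 0 := by exact_mod_cast hn0
      have h1 : ∀ d ∈ n.divisors, hh χ F d * (χ ((n / d : ℕ) : ZMod m) / ((n / d : ℕ) : ℂ)) =
          (bb (bet F) d : ℂ) * (χ (n : ZMod m) / n) := by
        intro d hd
        have hdn := Nat.dvd_of_mem_divisors hd
        unfold hh
        conv_rhs => rw [← Nat.mul_div_cancel' hdn]
        push_cast [map_mul]
        rw [mul_div_mul_comm]
        ring
      rw [Finset.sum_congr rfl h1, ← Finset.sum_mul, hbsum n hn0]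
      split_ifs
      · field_simp
      · simp
    have e2 : (∑ n ∈ (Finset.Icc 1 N).filter (fun n : ℕ => Int.gcd (n : ℤ) f = 1),
          χ ((n : ℕ) : ZMod m) / (n.totient : ℂ)) - L * cChi χ f =
        ∑ d ∈ Finset.Icc 1 N, hh χ F d * (∑ k ∈ Finset.Icc 1 (N / d), χ (k : ZMod m) / (k : ℂ) - L)
        + L * (∑ d ∈ Finset.Icc 1 N, hh χ F d - cChi χ f) := by
      rw [e1]
      simp only [mul_sub, Finset.sum_sub_distrib, ← Finset.sum_mul]
      ring
    have hE1 : ‖∑ d ∈ Finset.Icc 1 N, hh χ F d * (∑ k ∈ Finset.Icc 1 (N / d), χ (k : ZMod m) / (k : ℂ) - L)‖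
        ≤ 2 * B / (N + 1) * (F.divisors.card * (3 * (1 + Real.log N))) := by
      calc _ ≤ ∑ d ∈ Finset.Icc 1 N, 2 * B / (N + 1) * |bb (bet F) d| := by
            refine norm_sum_le_of_le _ fun d hd => ?_
            have hd0 : 0 < d := by simp at hd; omega
            have hd' : (0 : ℝ) < d := by exact_mod_cast hd0
            rw [norm_mul]
            have hlt : (N : ℝ) + 1 ≤ d * (((N / d : ℕ) : ℝ) + 1) := by
              exact_mod_cast Nat.lt_mul_div_succ N hd0
            calc _ ≤ |bb (bet F) d| / d * (2 * B / (((N / d : ℕ) : ℝ) + 1)) :=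
                  mul_le_mul (hh_norm χ F d) (hL1 _) (norm_nonneg _) (by positivity)
              _ = |bb (bet F) d| * (2 * B / (d * (((N / d : ℕ) : ℝ) + 1))) := by field_simp
              _ ≤ |bb (bet F) d| * (2 * B / (N + 1)) := by gcongr
              _ = _ := mul_comm _ _
        _ = 2 * B / (N + 1) * ∑ d ∈ Finset.Icc 1 N, |bb (bet F) d| := by rw [Finset.mul_sum]
        _ ≤ _ := by gcongr; exact b_head hf' N
    have hE2 : ‖∑ d ∈ Finset.Icc 1 N, hh χ F d - cChi χ f‖ ≤ F.divisors.card * (6 / (N + 1)) := by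
      have hs := (hh_summable χ hf').of_norm.hasSum.tendsto_sum_nat
      rw [← hh_tsum χ hf] at hs
      have hs' := hs.comp (Filter.tendsto_add_atTop_nat 1)
      have hlim := ((tendsto_const_nhds (x := ∑ d ∈ Finset.Icc 1 N, hh χ F d)).sub hs').norm
      refine le_of_tendsto hlim ?_
      filter_upwards [Filter.eventually_ge_atTop N] with M hM
      simp only [Function.comp]
      have h0 : hh χ F 0 = 0 := by simp [hh]
      have hr : ∑ d ∈ Finset.range (M + 1), hh χ F d =
          ∑ d ∈ Finset.Icc 1 N, hh χ F d + ∑ d ∈ Finset.Ioc N M, hh χ F d := by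
        have hd : Finset.range (M + 1) = insert 0 (Finset.Icc 1 N ∪ Finset.Ioc N M) := by
          ext n; simp only [Finset.mem_insert, Finset.mem_range, Finset.mem_union, Finset.mem_Icc, Finset.mem_Ioc]; omega
        have hdis : Disjoint (Finset.Icc 1 N) (Finset.Ioc N M) := by
          rw [Finset.disjoint_left]; intro n; simp only [Finset.mem_Icc, Finset.mem_Ioc]; omega
        rw [hd, Finset.sum_insert (by simp), h0, zero_add, Finset.sum_union hdis]
      rw [hr, sub_add_cancel_left, norm_neg]
      exact (norm_sum_le_of_le _ fun d _ => hh_norm χ F d).trans (b_tail hf' N M)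
    rw [e2]
    calc _ ≤ 2 * B / (N + 1) * (F.divisors.card * (3 * (1 + Real.log N))) +
          2 * B * (F.divisors.card * (6 / (N + 1))) := by
          refine (norm_add_le _ _).trans (add_le_add hE1 ?_)
          rw [norm_mul]
          exact mul_le_mul hLn hE2 (norm_nonneg _) (by positivity)
      _ = _ := by ring
  · have e1 : ∑ n ∈ (Finset.Icc 1 N).filter (fun n : ℕ => Int.gcd (n : ℤ) f = 1),
          χ ((n : ℕ) : ZMod m) * (n : ℂ) / (n.totient : ℂ) =
        ∑ d ∈ Finset.Icc 1 N, ((bb (bet F) d : ℂ) * χ (d : ZMod m)) *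
          ∑ k ∈ Finset.Icc 1 (N / d), χ (k : ZMod m) := by
      simp only [Finset.mul_sum]
      rw [← conv_sum N (fun d k => ((bb (bet F) d : ℂ) * χ (d : ZMod m)) * χ (k : ZMod m)),
        Finset.sum_filter]
      refine Finset.sum_congr rfl fun n hn => ?_
      have hn0 : n ≠ 0 := by simp at hn; omega
      have h1 : ∀ d ∈ n.divisors, ((bb (bet F) d : ℂ) * χ (d : ZMod m)) * χ ((n / d : ℕ) : ZMod m) =
          (bb (bet F) d : ℂ) * χ (n : ZMod m) := by
        intro d hd
        rw [mul_assoc, ← map_mul, ← Nat.cast_mul, Nat.mul_div_cancel' (Nat.dvd_of_mem_divisors hd)]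
      rw [Finset.sum_congr rfl h1, ← Finset.sum_mul, hbsum n hn0]
      split_ifs
      · ring
      · simp
    rw [e1]
    calc _ ≤ ∑ d ∈ Finset.Icc 1 N, |bb (bet F) d| * B := by
          refine norm_sum_le_of_le _ fun d hd => ?_
          rw [norm_mul, norm_mul, Complex.norm_real, Real.norm_eq_abs]
          refine mul_le_mul ?_ (hB _) (norm_nonneg _) (abs_nonneg _)
          calc _ ≤ |bb (bet F) d| * 1 := by
                gcongr; exact DirichletCharacter.norm_le_one _ _
            _ = _ := mul_one _
      _ = B * ∑ d ∈ Finset.Icc 1 N, |bb (bet F) d| := by rw [← Finset.sum_mul, mul_comm]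
      _ ≤ B * (F.divisors.card * (3 * (1 + Real.log N))) := by gcongr; exact b_head hf' N
      _ = _ := by ring


/-- **Character-twisted totient sums** (Lemma 5.2): for a non-principal `χ (mod m)`,
`f ≠ 0`, `x ≥ 2`:
`Σ_{n≤x,(n,f)=1} χ(n)/φ(n) = L(1,χ) c(χ,f) + O(τ(f) m^{1/2} log m log x / x)` and
`Σ_{n≤x,(n,f)=1} χ(n) n/φ(n) ≪ τ(f) m^{1/2} log m log x`. -/
theorem character_totient_sums :
    ∃ K : ℝ, ∀ (m : ℕ) (χ : DirichletCharacter ℂ m) (f : ℤ) (x : ℝ),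
      0 < m → χ ≠ 1 → f ≠ 0 → 2 ≤ x →
      ‖(∑ n ∈ (Finset.Icc 1 ⌊x⌋₊).filter (fun n : ℕ => Int.gcd (n : ℤ) f = 1),
          χ ((n : ℕ) : ZMod m) / (n.totient : ℂ)) - Lone χ * cChi χ f‖ ≤
        K * (f.natAbs.divisors.card : ℝ) * (m : ℝ) ^ ((1 : ℝ) / 2) *
          Real.log m * Real.log x / x ∧
      ‖∑ n ∈ (Finset.Icc 1 ⌊x⌋₊).filter (fun n : ℕ => Int.gcd (n : ℤ) f = 1),
          χ ((n : ℕ) : ZMod m) * (n : ℂ) / (n.totient : ℂ)‖ ≤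
        K * (f.natAbs.divisors.card : ℝ) * (m : ℝ) ^ ((1 : ℝ) / 2) *
          Real.log m * Real.log x := by
  refine ⟨252, fun m χ f x hm hχ hf hx => ?_⟩
  set N := ⌊x⌋₊ with hN
  have hx0 : 0 < x := by linarith
  have hN1 : 1 ≤ N := by rw [hN, Nat.one_le_floor_iff]; linarith
  have hNx : (N : ℝ) ≤ x := Nat.floor_le hx0.le
  have hxN : x ≤ (N : ℝ) + 1 := (Nat.lt_floor_add_one x).le
  have hN1' : (1 : ℝ) ≤ N := by exact_mod_cast hN1
  have hl1 : Real.log N ≤ Real.log x := Real.log_le_log (by linarith) hNx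
  have hl2 : Real.log 2 ≤ Real.log x := Real.log_le_log (by norm_num) hx
  have hl3 := log2_low
  have hl4 : 0 ≤ Real.log N := Real.log_nonneg hN1'
  have hlm : 0 ≤ Real.log m := Real.log_natCast_nonneg m
  obtain ⟨h1, h2⟩ := main_nat hm χ hχ f hf _ (pv_gen hm χ hχ) N
  rw [Real.sqrt_eq_rpow] at h1 h2
  set s : ℝ := (m : ℝ) ^ ((1 : ℝ) / 2) with hs
  have hs0 : 0 ≤ s := by positivity
  have hA : 0 ≤ 6 * s * Real.log m * f.natAbs.divisors.card := by positivity
  have hlx : 0 ≤ Real.log x := by linarith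
  constructor
  · refine h1.trans ?_
    calc _ ≤ 6 * s * Real.log m * f.natAbs.divisors.card * (42 * Real.log x) / x := by
          exact div_le_div₀ (mul_nonneg hA (by positivity)) (mul_le_mul_of_nonneg_left (by linarith) hA) hx0 hxN
      _ = _ := by ring
  · refine h2.trans ?_
    calc _ ≤ 6 * s * Real.log m * f.natAbs.divisors.card * (42 * Real.log x) := by
          exact mul_le_mul_of_nonneg_left (by linarith) hA
      _ = _ := by ring
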